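/- arXiv:2503.03357 — 4 statements merged into one kernel-verified Lean document; each statement's English description precedes it below -/
import Mathlib

section
/- Let n ∈ ℕ, A ∈ ℝ_max^{n×n} and x ∈ ℝ_max^n. The following are equivalent: (i) x ≥ A ⊗ x; (ii) x ≥ A* ⊗ x; (iii) x = A* ⊗ x; (iv) x ∈ Im A*. -/
noncomputable section

open scoped Classical

/-- Max-plus matrix-vector product: `(A ⊗ x)_i = sup_j (A_{ij} + x_j)`. -/
def mpMulVec {N P : Type*} (A : N → P → EReal) (x : P → EReal) : N → EReal :=
  fun i => ⨆ j, A i j + x j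

/-- Max-plus matrix-matrix product. -/
def mpMulMat {N P Q : Type*} (A : N → P → EReal) (B : P → Q → EReal) : N → Q → EReal :=
  fun i j => ⨆ k, A i k + B k j

/-- Max-plus identity matrix `E`. -/
def mpId {N : Type*} [DecidableEq N] : N → N → EReal :=
  fun i j => if i = j then (0 : EReal) else ⊥

/-- Max-plus matrix powers: `A^0 = E`, `A^{k+1} = A^k ⊗ A`. -/
def mpPow {N : Type*} [DecidableEq N] (A : N → N → EReal) : ℕ → N → N → EReal
  | 0 => mpId
  | k + 1 => mpMulMat (mpPow A k) A

/-- Kleene star `A* = sup_{k ≥ 0} A^k` (entrywise supremum). -/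
def mpStar {N : Type*} [DecidableEq N] (A : N → N → EReal) : N → N → EReal :=
  fun i j => ⨆ k : ℕ, mpPow A k i j

/-- Image of a matrix: `Im U = { U ⊗ u : u ∈ ℝ_max^P } ⊆ ℝ_max^N`. -/
def mpIm {N P : Type*} (U : N → P → EReal) : Set (N → EReal) :=
  { x | (∀ i, x i ≠ ⊤) ∧ ∃ u : P → EReal, (∀ j, u j ≠ ⊤) ∧ x = mpMulVec U u }

/-- Existence of a positive-weight circuit in the precedence graph `G(A)`. -/
def hasPosCircuit {N : Type*} (A : N → N → EReal) : Prop :=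
  ∃ (l : ℕ) (p : ℕ → N), p l = p 0 ∧ (∀ t < l, A (p (t + 1)) (p t) ≠ ⊥) ∧
    0 < ∑ t ∈ Finset.range l, A (p (t + 1)) (p t)

/-- The block-tridiagonal matrix `M_[K]` with diagonal blocks `C`,
superdiagonal blocks `L`, subdiagonal blocks `R`. -/
def MK {n : ℕ} (L C R : Fin n → Fin n → EReal) (K : ℕ) :
    Fin K × Fin n → Fin K × Fin n → EReal :=
  fun p q =>
    if p.1.val = q.1.val then C p.2 q.2
    else if p.1.val + 1 = q.1.val then L p.2 q.2
    else if q.1.val + 1 = p.1.val then R p.2 q.2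
    else ⊥

/-- The infinite block-tridiagonal matrix `M_[∞]`, indexed by `ℕ × Fin n`. -/
def Minf {n : ℕ} (L C R : Fin n → Fin n → EReal) :
    ℕ × Fin n → ℕ × Fin n → EReal :=
  fun p q =>
    if p.1 = q.1 then C p.2 q.2
    else if p.1 + 1 = q.1 then L p.2 q.2
    else if q.1 + 1 = p.1 then R p.2 q.2
    else ⊥

/-- Existence of a finite real trajectory `x : {1,…,K} → ℝ^n` satisfying
`x(k) ≥ C ⊗ x(k)`, `x(k) ≥ L ⊗ x(k+1)` and `x(k+1) ≥ R ⊗ x(k)`. -/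
def FiniteTraj {n : ℕ} (L C R : Fin n → Fin n → EReal) (K : ℕ) : Prop :=
  ∃ x : Fin K → Fin n → ℝ,
    (∀ k : Fin K, ∀ i, mpMulVec C (fun j => (x k j : EReal)) i ≤ (x k i : EReal)) ∧
    (∀ k : Fin K, ∀ h : k.val + 1 < K, ∀ i,
      mpMulVec L (fun j => (x ⟨k.val + 1, h⟩ j : EReal)) i ≤ (x k i : EReal) ∧
      mpMulVec R (fun j => (x k j : EReal)) i ≤ (x ⟨k.val + 1, h⟩ i : EReal))

/-- Weak consistency of system (8). -/
def WeaklyConsistent {n : ℕ} (L C R : Fin n → Fin n → EReal) : Prop :=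
  ∀ K : ℕ, FiniteTraj L C R K

/-- Consistency of system (8): existence of an infinite real trajectory. -/
def Consistent {n : ℕ} (L C R : Fin n → Fin n → EReal) : Prop :=
  ∃ x : ℕ → Fin n → ℝ, ∀ k : ℕ,
    (∀ i, mpMulVec L (fun j => (x (k + 1) j : EReal)) i ≤ (x k i : EReal)) ∧
    (∀ i, mpMulVec C (fun j => (x k j : EReal)) i ≤ (x k i : EReal)) ∧
    (∀ i, mpMulVec R (fun j => (x k j : EReal)) i ≤ (x (k + 1) i : EReal))

/-- The sequence `Π_0 = C*`, `Π_{k+1} = (L ⊗ Π_k ⊗ R ⊕ C)*`. -/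
def PiSeq {n : ℕ} (L C R : Fin n → Fin n → EReal) : ℕ → Fin n → Fin n → EReal
  | 0 => mpStar C
  | k + 1 => mpStar (fun i j => max (mpMulMat (mpMulMat L (PiSeq L C R k)) R i j) (C i j))

/-- Lifted matrix `Ā = [[ε, E], [ε, ε]]`. -/
def Abar (n : ℕ) : Fin n ⊕ Fin n → Fin n ⊕ Fin n → EReal :=
  fun p q =>
    match p, q with
    | Sum.inl i, Sum.inr j => mpId i j
    | _, _ => ⊥

/-- Lifted matrix `B̄ = [ε; E]`. -/
def Bbar (n : ℕ) : Fin n ⊕ Fin n → Fin n → EReal :=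
  fun p j =>
    match p with
    | Sum.inl _ => ⊥
    | Sum.inr i => mpId i j

/-- Lifted matrix `H = [[C, L], [R, C]]`. -/
def Hmat {n : ℕ} (L C R : Fin n → Fin n → EReal) :
    Fin n ⊕ Fin n → Fin n ⊕ Fin n → EReal :=
  fun p q =>
    match p, q with
    | Sum.inl i, Sum.inl j => C i j
    | Sum.inl i, Sum.inr j => L i j
    | Sum.inr i, Sum.inl j => R i j
    | Sum.inr i, Sum.inr j => C i j

/-- The semimodule `K = Im H*`. -/
def Kset {n : ℕ} (L C R : Fin n → Fin n → EReal) : Set (Fin n ⊕ Fin n → EReal) :=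
  mpIm (mpStar (Hmat L C R))

/-- The map `φ(X) = X ∩ { x ∈ ℝ_max^N : ∃ u ∈ ℝ_max^M, A ⊗ x ⊕ B ⊗ u ∈ X }`. -/
def mpPhi {N M : Type*} (A : N → N → EReal) (B : N → M → EReal)
    (X : Set (N → EReal)) : Set (N → EReal) :=
  X ∩ { x | (∀ i, x i ≠ ⊤) ∧ ∃ u : M → EReal, (∀ j, u j ≠ ⊤) ∧
    (fun i => max (mpMulVec A x i) (mpMulVec B u i)) ∈ X }

/-- Controlled trajectory: `x(1) = x0`, `x(k+1) = A ⊗ x(k) ⊕ B ⊗ u(k)`. -/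
def mpTraj {N M : Type*} (A : N → N → EReal) (B : N → M → EReal)
    (x0 : N → EReal) (u : ℕ → M → EReal) : ℕ → N → EReal
  | 0 => x0
  | k + 1 => fun i => max (mpMulVec A (mpTraj A B x0 u k) i) (mpMulVec B (u k) i)

/-- `K^♯`: states of `K` from which some control keeps the whole trajectory in `K`. -/
def mpKsharp {N M : Type*} (A : N → N → EReal) (B : N → M → EReal)
    (K : Set (N → EReal)) : Set (N → EReal) :=
  { x | x ∈ K ∧ ∃ u : ℕ → M → EReal, (∀ k j, u k j ≠ ⊤) ∧
    ∀ k : ℕ, mpTraj A B x u k ∈ K }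

/-- Real vectors `ℝ^N` inside `ℝ̄^N`. -/
def RealVecs {N : Type*} : Set (N → EReal) := { x | ∀ i, x i ≠ ⊤ ∧ x i ≠ ⊥ }

/-- Semimodules of `ℝ_max^N`: closed under entrywise max and scalar addition. -/
def IsSemimodule {N : Type*} (X : Set (N → EReal)) : Prop :=
  (∀ x ∈ X, ∀ i, x i ≠ ⊤) ∧
  (∀ x ∈ X, ∀ y ∈ X, (fun i => max (x i) (y i)) ∈ X) ∧
  (∀ x ∈ X, ∀ lam : EReal, lam ≠ ⊤ → (fun i => lam + x i) ∈ X)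

/-- Embedding of the first two block indices into `Fin (k+2) × Fin n`. -/
def emb2 {n : ℕ} (k : ℕ) : Fin n ⊕ Fin n → Fin (k + 2) × Fin n
  | Sum.inl i => (⟨0, by omega⟩, i)
  | Sum.inr i => (⟨1, by omega⟩, i)

/-- `S_{k+2}`: top-left `2n × 2n` submatrix of `(M_[k+2])*`. -/
def Smat {n : ℕ} (L C R : Fin n → Fin n → EReal) (k : ℕ) :
    Fin n ⊕ Fin n → Fin n ⊕ Fin n → EReal :=
  fun p q => mpStar (MK L C R (k + 2)) (emb2 k p) (emb2 k q)

/-- Embedding of the first two block indices into `ℕ × Fin n`. -/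
def embInf {n : ℕ} : Fin n ⊕ Fin n → ℕ × Fin n
  | Sum.inl i => (0, i)
  | Sum.inr i => (1, i)

/-- `S_∞`: top-left `2n × 2n` submatrix of `(M_[∞])*`. -/
def Sinf {n : ℕ} (L C R : Fin n → Fin n → EReal) :
    Fin n ⊕ Fin n → Fin n ⊕ Fin n → EReal :=
  fun p q => mpStar (Minf L C R) (embInf p) (embInf q)

/-- A common bound for `a + f i` also bounds `a + ⨆ i, f i`, even at infinite values. -/
theorem EReal.add_iSup_le_of_forall {ι : Sort*} {f : ι → EReal} {a c : EReal}
    (h : ∀ i, a + f i ≤ c) : a + ⨆ i, f i ≤ c := by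
  induction a with
  | bot => simp
  | coe r =>
    rw [add_comm, ← EReal.le_sub_iff_add_le (by simp) (by simp)]
    refine iSup_le fun i => ?_
    rw [EReal.le_sub_iff_add_le (by simp) (by simp), add_comm]
    exact h i
  | top =>
    by_cases hf : ∀ i, f i = ⊥
    · simp [hf]
    · push Not at hf
      obtain ⟨i, hi⟩ := hf
      have hc := h i
      rw [EReal.top_add_of_ne_bot hi] at hc
      exact le_top.trans hc

theorem EReal.iSup_add_le_of_forall {ι : Sort*} {f : ι → EReal} {a c : EReal}
    (h : ∀ i, f i + a ≤ c) : (⨆ i, f i) + a ≤ c := by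
  rw [add_comm]
  exact EReal.add_iSup_le_of_forall fun i => by rw [add_comm]; exact h i

section MaxPlus

variable {N : Type*} [DecidableEq N] (A : N → N → EReal)

theorem add_mpPow_le_mpPow_succ (k : ℕ) (i j l : N) :
    A i j + mpPow A k j l ≤ mpPow A (k + 1) i l := by
  induction k generalizing l with
  | zero =>
    by_cases h : j = l
    · subst h
      refine le_trans ?_ (le_iSup (fun m => mpPow A 0 i m + A m j) i)
      simp [mpPow, mpId]
    · simp [mpPow, mpId, h]
  | succ k ih =>
    refine EReal.add_iSup_le_of_forall fun m => ?_
    rw [← add_assoc]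
    exact (add_le_add_left (ih m) _).trans
      (le_iSup (fun m => mpPow A (k + 1) i m + A m l) m)

theorem add_mpStar_le_mpStar (i j l : N) : A i j + mpStar A j l ≤ mpStar A i l :=
  EReal.add_iSup_le_of_forall fun k =>
    (add_mpPow_le_mpPow_succ A k i j l).trans (le_iSup (fun k => mpPow A k i l) (k + 1))

theorem zero_le_mpStar_self (i : N) : 0 ≤ mpStar A i i :=
  le_trans (by simp [mpPow, mpId]) (le_iSup (fun k => mpPow A k i i) 0)

theorem le_mpMulVec_mpStar (x : N → EReal) (i : N) : x i ≤ mpMulVec (mpStar A) x i := by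
  refine le_trans ?_ (le_iSup (fun j => mpStar A i j + x j) i)
  simpa using add_le_add_left (zero_le_mpStar_self A i) (x i)

variable {A}

theorem mpPow_add_le {x : N → EReal} (h : ∀ i, mpMulVec A x i ≤ x i) (k : ℕ) (i j : N) :
    mpPow A k i j + x j ≤ x i := by
  induction k generalizing j with
  | zero =>
    by_cases hij : i = j
    · subst hij
      simp [mpPow, mpId]
    · simp [mpPow, mpId, hij]
  | succ k ih =>
    refine EReal.iSup_add_le_of_forall fun m => ?_
    rw [add_assoc]
    exact (add_le_add_right ((le_iSup (fun j => A m j + x j) j).trans (h m)) _).trans (ih m)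

theorem mpMulVec_mpStar_le {x : N → EReal} (h : ∀ i, mpMulVec A x i ≤ x i) (i : N) :
    mpMulVec (mpStar A) x i ≤ x i :=
  iSup_le fun j => EReal.iSup_add_le_of_forall fun k => mpPow_add_le h k i j

variable (A)

theorem mpMulVec_mpMulVec_mpStar_le (u : N → EReal) (i : N) :
    mpMulVec A (mpMulVec (mpStar A) u) i ≤ mpMulVec (mpStar A) u i := by
  refine iSup_le fun j => EReal.add_iSup_le_of_forall fun l => ?_
  rw [← add_assoc]
  exact (add_le_add_left (add_mpStar_le_mpStar A i j l) _).trans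
    (le_iSup (fun l => mpStar A i l + u l) l)

end MaxPlus

/-- For `A ∈ ℝ_max^{n×n}` and `x ∈ ℝ_max^n`, TFAE:
(i) `x ≥ A ⊗ x`; (ii) `x ≥ A* ⊗ x`; (iii) `x = A* ⊗ x`; (iv) `x ∈ Im A*`. -/
theorem stmt_0 (n : ℕ) (hn : 0 < n) (A : Fin n → Fin n → EReal)
    (hA : ∀ i j, A i j ≠ ⊤) (x : Fin n → EReal) (hx : ∀ i, x i ≠ ⊤) :
    [(∀ i, mpMulVec A x i ≤ x i),
     (∀ i, mpMulVec (mpStar A) x i ≤ x i),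
     x = mpMulVec (mpStar A) x,
     x ∈ mpIm (mpStar A)].TFAE := by
  tfae_have 1 → 2 := mpMulVec_mpStar_le
  tfae_have 2 → 3 := fun h => funext fun i => le_antisymm (le_mpMulVec_mpStar A x i) (h i)
  tfae_have 3 → 4 := fun h => ⟨hx, x, hx, h⟩
  tfae_have 4 → 1 := by
    rintro ⟨-, u, -, rfl⟩
    exact mpMulVec_mpMulVec_mpStar_le A u
  tfae_finish
end
end

section
/- Let n ∈ ℕ and A ∈ ℝ_max^{n×n}. Then (A*)_{ij} = +∞ for some i, j if and only if the precedence graph G(A) contains a positive-weight circuit. Consequently, the precedence constraints x_i ≥ A_{ij} + x_j (for all i, j) admit a real solution x ∈ ℝ^n if and only if G(A) contains no positive-weight circuit. -/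
noncomputable section

open scoped Classical

/-- The weight of the first `l` steps of `p` in the precedence graph of `A`. -/
def pathWeight {N : Type*} (A : N → N → EReal) (p : ℕ → N) (l : ℕ) : EReal :=
  ∑ t ∈ Finset.range l, A (p (t + 1)) (p t)

theorem pathWeight_add {N : Type*} (A : N → N → EReal) (p : ℕ → N) (a b : ℕ) :
    pathWeight A p (a + b) = pathWeight A p a + pathWeight A (fun t => p (a + t)) b :=
  Finset.sum_range_add _ a b

theorem mpPow_add_le_succ {N : Type*} [DecidableEq N] (A : N → N → EReal) (l : ℕ) (i k j : N) :
    mpPow A l i k + A k j ≤ mpPow A (l + 1) i j :=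
  le_iSup (fun k => mpPow A l i k + A k j) k

theorem pathWeight_le_mpPow {N : Type*} [DecidableEq N] (A : N → N → EReal) (l : ℕ)
    (p : ℕ → N) : pathWeight A p l ≤ mpPow A l (p l) (p 0) := by
  induction l generalizing p with
  | zero => simp [pathWeight, mpPow, mpId]
  | succ l ih =>
    rw [pathWeight, Finset.sum_range_succ']
    exact (add_le_add_left (ih fun t => p (t + 1)) _).trans (mpPow_add_le_succ A l _ _ _)

theorem le_mpPow_one {N : Type*} [DecidableEq N] (A : N → N → EReal) (i j : N) :
    A i j ≤ mpPow A 1 i j := by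
  simpa [mpPow, mpId] using mpPow_add_le_succ A 0 i i j

theorem exists_mpPow_succ_eq {N : Type*} [DecidableEq N] [Finite N] (A : N → N → EReal)
    (l : ℕ) (i j : N) : ∃ k, mpPow A l i k + A k j = mpPow A (l + 1) i j :=
  have : Nonempty N := ⟨i⟩
  exists_eq_ciSup_of_finite (f := fun k => mpPow A l i k + A k j)

theorem mpPow_ne_top {N : Type*} [DecidableEq N] [Finite N] {A : N → N → EReal}
    (hA : ∀ i j, A i j ≠ ⊤) (l : ℕ) (i j : N) : mpPow A l i j ≠ ⊤ := by
  induction l generalizing j with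
  | zero => simp only [mpPow, mpId]; split_ifs <;> simp
  | succ l ih =>
    obtain ⟨k, hk⟩ := exists_mpPow_succ_eq A l i j
    rw [← hk]
    exact EReal.add_ne_top (ih k) (hA k j)

theorem mpPow_add_mpPow_le {N : Type*} [DecidableEq N] [Finite N] (A : N → N → EReal)
    (a b : ℕ) (i k j : N) : mpPow A a i k + mpPow A b k j ≤ mpPow A (a + b) i j := by
  induction b generalizing j with
  | zero =>
    by_cases h : k = j <;> simp [mpPow, mpId, h]
  | succ b ih =>
    obtain ⟨m, hm⟩ := exists_mpPow_succ_eq A b k j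
    rw [← hm, ← add_assoc]
    exact (add_le_add_left (ih m) _).trans (mpPow_add_le_succ A (a + b) i m j)

/-- A power entry different from `-∞` is the weight of a path of the precedence graph. -/
theorem exists_path_of_mpPow_ne_bot {N : Type*} [DecidableEq N] [Finite N]
    (A : N → N → EReal) (l : ℕ) (i j : N) (h : mpPow A l i j ≠ ⊥) :
    ∃ p : ℕ → N, p l = i ∧ p 0 = j ∧ (∀ t < l, A (p (t + 1)) (p t) ≠ ⊥) ∧
      pathWeight A p l = mpPow A l i j := by
  induction l generalizing j with
  | zero =>
    have hij : i = j := by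
      by_contra hij
      exact h (by simp [mpPow, mpId, hij])
    exact ⟨fun _ => i, rfl, hij, by simp, by simp [pathWeight, mpPow, mpId, hij]⟩
  | succ l ih =>
    obtain ⟨k, hk⟩ := exists_mpPow_succ_eq A l i j
    rw [← hk] at h
    obtain ⟨h₁, h₂⟩ : mpPow A l i k ≠ ⊥ ∧ A k j ≠ ⊥ := by
      simpa [EReal.add_eq_bot_iff] using h
    obtain ⟨p, hpl, hp0, hp, hw⟩ := ih k h₁
    refine ⟨fun t => Nat.casesOn t j p, hpl, rfl, ?_, ?_⟩
    · rintro (_ | t) ht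
      · simpa [hp0] using h₂
      · exact hp t (by omega)
    · rw [pathWeight, Finset.sum_range_succ', ← hk, ← hw, ← hp0]
      rfl

/-- Without positive-weight circuits, excising circuits bounds every power by a short one. -/
theorem exists_mpPow_le_lt_card {N : Type*} [DecidableEq N] [Fintype N] {A : N → N → EReal}
    (hc : ¬ hasPosCircuit A) (l : ℕ) (i j : N) :
    ∃ k < Fintype.card N, mpPow A l i j ≤ mpPow A k i j := by
  induction l using Nat.strong_induction_on with
  | _ l ih =>
    rcases lt_or_ge l (Fintype.card N) with hl | hl
    · exact ⟨l, hl, le_rfl⟩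
    by_cases hbot : mpPow A l i j = ⊥
    · exact ⟨0, Fintype.card_pos_iff.mpr ⟨i⟩, by simp [hbot]⟩
    obtain ⟨p, rfl, rfl, hp, hw⟩ := exists_path_of_mpPow_ne_bot A l i j hbot
    obtain ⟨a, b, hab, hpab⟩ : ∃ a b : Fin (l + 1), a < b ∧ p a = p b := by
      obtain ⟨a, b, hne, h⟩ := Fintype.exists_ne_map_eq_of_card_lt
        (fun t : Fin (l + 1) => p t) (by rw [Fintype.card_fin]; omega)
      rcases lt_or_gt_of_ne hne with h' | h'
      · exact ⟨a, b, h', h⟩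
      · exact ⟨b, a, h', h.symm⟩
    obtain ⟨a, ha⟩ := a
    obtain ⟨b, hb⟩ := b
    simp only [Fin.mk_lt_mk] at hab hpab
    obtain ⟨c, rfl⟩ := Nat.exists_eq_add_of_le hab.le
    obtain ⟨d, rfl⟩ := Nat.exists_eq_add_of_le (Nat.lt_succ_iff.mp hb)
    have hcycle : pathWeight A (fun t => p (a + t)) c ≤ 0 := by
      by_contra hpos
      exact hc ⟨c, fun t => p (a + t), hpab.symm, fun t ht => hp (a + t) (by omega),
        not_le.mp hpos⟩
    have hshort : mpPow A (a + c + d) (p (a + c + d)) (p 0) ≤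
        mpPow A (d + a) (p (a + c + d)) (p 0) := by
      rw [← hw, pathWeight_add, pathWeight_add]
      calc _ ≤ mpPow A a (p a) (p 0) + 0 + mpPow A d (p (a + c + d)) (p (a + c)) :=
            add_le_add (add_le_add (pathWeight_le_mpPow A a p) hcycle)
              (pathWeight_le_mpPow A d fun t => p (a + c + t))
        _ = mpPow A d (p (a + c + d)) (p a) + mpPow A a (p a) (p 0) := by
            rw [add_zero, add_comm, hpab]
        _ ≤ _ := mpPow_add_mpPow_le A d a _ _ _
    obtain ⟨k, hk, hle⟩ := ih (d + a) (by omega)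
    exact ⟨k, hk, hshort.trans hle⟩

theorem exists_potential_of_not_hasPosCircuit {N : Type*} [Fintype N] {A : N → N → EReal}
    (hA : ∀ i j, A i j ≠ ⊤) (hc : ¬ hasPosCircuit A) :
    ∃ x : N → ℝ, ∀ i j, A i j + (x j : EReal) ≤ (x i : EReal) := by
  classical
  rcases isEmpty_or_nonempty N with hN | hN
  · exact ⟨fun _ => 0, fun i => hN.elim i⟩
  have : Nonempty (Fin (Fintype.card N)) := ⟨⟨0, Fintype.card_pos⟩⟩
  let y : N → EReal := fun i => ⨆ q : N × Fin (Fintype.card N), mpPow A q.2 i q.1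
  have hatt : ∀ i, ∃ q : N × Fin (Fintype.card N), mpPow A q.2 i q.1 = y i := fun i =>
    exists_eq_ciSup_of_finite (f := fun q : N × Fin (Fintype.card N) => mpPow A q.2 i q.1)
  have hle : ∀ l i m, mpPow A l i m ≤ y i := fun l i m => by
    obtain ⟨k, hk, h⟩ := exists_mpPow_le_lt_card hc l i m
    exact h.trans (le_iSup (fun q : N × Fin (Fintype.card N) => mpPow A q.2 i q.1) (m, ⟨k, hk⟩))
  have hcoe : ∀ i, ((y i).toReal : EReal) = y i := fun i => by
    refine EReal.coe_toReal ?_ ?_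
    · obtain ⟨q, hq⟩ := hatt i
      exact hq ▸ mpPow_ne_top hA _ _ _
    · have h0 : (0 : EReal) ≤ y i := by simpa [mpPow, mpId] using hle 0 i i
      exact ((EReal.bot_lt_zero).trans_le h0).ne'
  refine ⟨fun i => (y i).toReal, fun i j => ?_⟩
  rw [hcoe, hcoe]
  obtain ⟨⟨m, k⟩, hq⟩ := hatt j
  rw [← hq]
  exact (add_le_add_left (le_mpPow_one A i j) _).trans
    ((mpPow_add_mpPow_le A 1 k i j m).trans (hle _ i m))

theorem mpStar_ne_top_of_potential {N : Type*} [DecidableEq N] {A : N → N → EReal}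
    {x : N → ℝ} (hx : ∀ i j, A i j + (x j : EReal) ≤ (x i : EReal)) (i j : N) :
    mpStar A i j ≠ ⊤ := by
  have hA : ∀ i j, A i j ≤ ((x i - x j : ℝ) : EReal) := fun i j => by
    rw [EReal.coe_sub]
    exact EReal.le_sub_iff_add_le (by simp) (by simp) |>.mpr (hx i j)
  have hpow : ∀ l j, mpPow A l i j ≤ ((x i - x j : ℝ) : EReal) := fun l => by
    induction l with
    | zero =>
      intro j
      by_cases h : i = j <;> simp [mpPow, mpId, h]
    | succ l ih =>
      refine fun j => iSup_le fun k => (add_le_add (ih k) (hA k j)).trans ?_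
      rw [← EReal.coe_add, sub_add_sub_cancel]
  exact ((iSup_le fun l => hpow l j).trans_lt (EReal.coe_lt_top _)).ne

theorem exists_mpStar_eq_top_of_hasPosCircuit {N : Type*} [DecidableEq N] [Finite N]
    {A : N → N → EReal} (h : hasPosCircuit A) : ∃ i, mpStar A i i = ⊤ := by
  obtain ⟨l, p, hpl, -, hpos⟩ := h
  refine ⟨p 0, ?_⟩
  obtain ⟨r, hr0, hr⟩ := EReal.lt_iff_exists_real_btwn.mp hpos
  have hr0 : 0 < r := by exact_mod_cast hr0
  have hrl : (r : EReal) ≤ mpPow A l (p 0) (p 0) := by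
    have h := pathWeight_le_mpPow A l p
    rw [hpl] at h
    exact hr.le.trans h
  have hmul : ∀ m : ℕ, ((m * r : ℝ) : EReal) ≤ mpPow A (m * l) (p 0) (p 0) := fun m => by
    induction m with
    | zero => simp [mpPow, mpId]
    | succ m ih =>
      rw [Nat.cast_succ, add_one_mul, EReal.coe_add, Nat.succ_mul]
      exact (add_le_add ih hrl).trans (mpPow_add_mpPow_le A _ _ _ _ _)
  refine EReal.eq_top_iff_forall_lt _ |>.mpr fun y => ?_
  obtain ⟨m, hm⟩ := exists_nat_gt (y / r)
  calc (y : EReal) < ((m * r : ℝ) : EReal) := by exact_mod_cast (div_lt_iff₀ hr0).mp hm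
    _ ≤ mpPow A (m * l) (p 0) (p 0) := hmul m
    _ ≤ mpStar A (p 0) (p 0) := le_iSup (fun k => mpPow A k (p 0) (p 0)) (m * l)

/-- For finite `A ∈ ℝ_max^{n×n}`: `(A*)_{ij} = +∞` for some `i,j`
iff `G(A)` has a positive-weight circuit; consequently the precedence
constraints have a real solution iff `G(A)` has no positive-weight circuit. -/
theorem stmt_3 (n : ℕ) (hn : 0 < n) (A : Fin n → Fin n → EReal)
    (hA : ∀ i j, A i j ≠ ⊤) :
    ((∃ i j, mpStar A i j = ⊤) ↔ hasPosCircuit A) ∧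
    ((∃ x : Fin n → ℝ, ∀ i j, A i j + (x j : EReal) ≤ (x i : EReal)) ↔
      ¬ hasPosCircuit A) := by
  refine ⟨⟨?_, fun h => ?_⟩, ?_, exists_potential_of_not_hasPosCircuit hA⟩
  · rintro ⟨i, j, hij⟩
    by_contra hc
    obtain ⟨x, hx⟩ := exists_potential_of_not_hasPosCircuit hA hc
    exact mpStar_ne_top_of_potential hx i j hij
  · obtain ⟨i, hi⟩ := exists_mpStar_eq_top_of_hasPosCircuit h
    exact ⟨i, i, hi⟩
  · rintro ⟨x, hx⟩ h
    obtain ⟨i, hi⟩ := exists_mpStar_eq_top_of_hasPosCircuit h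
    exact mpStar_ne_top_of_potential hx i i hi
end
end

section
/- Let n ∈ ℕ and A, L, C, R̃ ∈ ℝ_max^{n×n}, and set R = A ⊕ R̃ (entrywise max). There exist sequences x : ℕ → ℝ^n and u : ℕ → ℝ_max^n such that for all k ∈ ℕ, x(k+1) = A ⊗ x(k) ⊕ u(k) and moreover x(k) ≥ L ⊗ x(k+1), x(k) ≥ C ⊗ x(k), and x(k+1) ≥ R̃ ⊗ x(k), if and only if there exists a sequence x : ℕ → ℝ^n such that for all k ∈ ℕ: x(k) ≥ L ⊗ x(k+1), x(k) ≥ C ⊗ x(k), and x(k+1) ≥ R ⊗ x(k). -/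
noncomputable section

open scoped Classical

/-- The max-plus matrix-vector product distributes over the entrywise max of matrices. -/
theorem mpMulVec_max {N P : Type*} (A B : N → P → EReal) (x : P → EReal) (i : N) :
    mpMulVec (fun i j => max (A i j) (B i j)) x i = max (mpMulVec A x i) (mpMulVec B x i) := by
  have h (j : P) : max (A i j) (B i j) + x j = max (A i j + x j) (B i j + x j) :=
    Monotone.map_max (f := fun t : EReal => t + x j) fun _ _ hab => add_le_add_left hab _
  simp only [mpMulVec, h]
  exact iSup_sup_eq

/-- with `R = A ⊕ R̃`, the fully actuated system
`x(k+1) = A ⊗ x(k) ⊕ u(k)` with constraints `x(k) ≥ L ⊗ x(k+1)`,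
`x(k) ≥ C ⊗ x(k)`, `x(k+1) ≥ R̃ ⊗ x(k)` admits a real trajectory iff
the system `x(k) ≥ L ⊗ x(k+1)`, `x(k) ≥ C ⊗ x(k)`, `x(k+1) ≥ R ⊗ x(k)` does. -/
theorem stmt_4 (n : ℕ) (hn : 0 < n) (A L C Rt : Fin n → Fin n → EReal)
    (hA : ∀ i j, A i j ≠ ⊤) (hL : ∀ i j, L i j ≠ ⊤)
    (hC : ∀ i j, C i j ≠ ⊤) (hRt : ∀ i j, Rt i j ≠ ⊤) :
    (∃ (x : ℕ → Fin n → ℝ) (u : ℕ → Fin n → EReal),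
      (∀ k i, u k i ≠ ⊤) ∧
      ∀ k : ℕ,
        (∀ i, (x (k + 1) i : EReal) =
          max (mpMulVec A (fun j => (x k j : EReal)) i) (u k i)) ∧
        (∀ i, mpMulVec L (fun j => (x (k + 1) j : EReal)) i ≤ (x k i : EReal)) ∧
        (∀ i, mpMulVec C (fun j => (x k j : EReal)) i ≤ (x k i : EReal)) ∧
        (∀ i, mpMulVec Rt (fun j => (x k j : EReal)) i ≤ (x (k + 1) i : EReal))) ↔
    (∃ x : ℕ → Fin n → ℝ, ∀ k : ℕ,
      (∀ i, mpMulVec L (fun j => (x (k + 1) j : EReal)) i ≤ (x k i : EReal)) ∧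
      (∀ i, mpMulVec C (fun j => (x k j : EReal)) i ≤ (x k i : EReal)) ∧
      (∀ i, mpMulVec (fun i j => max (A i j) (Rt i j))
        (fun j => (x k j : EReal)) i ≤ (x (k + 1) i : EReal))) := by
  simp only [mpMulVec_max, max_le_iff]
  constructor
  · rintro ⟨x, u, -, h⟩
    refine ⟨x, fun k => ?_⟩
    obtain ⟨hx, hLx, hCx, hRx⟩ := h k
    exact ⟨hLx, hCx, fun i => ⟨(le_max_left _ _).trans_eq (hx i).symm, hRx i⟩⟩
  · rintro ⟨x, h⟩
    refine ⟨x, fun k i => x (k + 1) i, fun k i => EReal.coe_ne_top _, fun k => ?_⟩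
    obtain ⟨hLx, hCx, hRx⟩ := h k
    exact ⟨fun i => (max_eq_right (hRx i).1).symm, hLx, hCx, fun i => (hRx i).2⟩
end
end

section
/- Let n ∈ ℕ and L, C, R ∈ ℝ_max^{n×n}. For every K ∈ ℕ, there exists a finite trajectory x : {1,…,K} → ℝ^n satisfying x(k) ≥ L ⊗ x(k+1) for k ≤ K-1, x(k) ≥ C ⊗ x(k) for k ≤ K, and x(k+1) ≥ R ⊗ x(k) for k ≤ K-1, if and only if the precedence graph G(M_[K]) contains no positive-weight circuit. Consequently, the system is weakly consistent if and only if for all K ∈ ℕ, G(M_[K]) contains no positive-weight circuit. -/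
noncomputable section

open scoped Classical

/-- A weighted digraph on a finite vertex set without positive-weight circuits has walks of
bounded weight. -/
theorem exists_walk_weight_le {N : Type*} [Finite N] (E : N → N → Prop) (w : N → N → ℝ)
    (hc : ∀ (l : ℕ) (p : ℕ → N), p l = p 0 → (∀ t < l, E (p (t + 1)) (p t)) →
      ∑ t ∈ Finset.range l, w (p (t + 1)) (p t) ≤ 0) :
    ∃ M : ℝ, ∀ (l : ℕ) (p : ℕ → N), (∀ t < l, E (p (t + 1)) (p t)) →
      ∑ t ∈ Finset.range l, w (p (t + 1)) (p t) ≤ M := by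
  have := Fintype.ofFinite N
  obtain ⟨B, hB⟩ := (Set.finite_range fun e : N × N => w e.1 e.2).bddAbove
  have hB' : ∀ i j, w i j ≤ max B 0 := fun i j =>
    (hB ⟨(i, j), rfl⟩).trans (le_max_left _ _)
  refine ⟨Fintype.card N * max B 0, fun l => ?_⟩
  induction l using Nat.strong_induction_on with
  | _ l ih =>
  intro p hp
  by_cases hl : l ≤ Fintype.card N
  · calc ∑ t ∈ Finset.range l, w (p (t + 1)) (p t)
        ≤ ∑ _t ∈ Finset.range l, max B 0 := Finset.sum_le_sum fun t _ => hB' _ _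
      _ = l * max B 0 := by simp
      _ ≤ Fintype.card N * max B 0 := by gcongr
  · obtain ⟨i, j, hij, hjl, hpij⟩ : ∃ i j : ℕ, i < j ∧ j ≤ l ∧ p i = p j := by
      obtain ⟨a, b, hab, h⟩ := Fintype.exists_ne_map_eq_of_card_lt
        (fun t : Fin (l + 1) => p t) (by simp; omega)
      rcases lt_or_gt_of_ne hab with h' | h'
      · exact ⟨a, b, h', by omega, h⟩
      · exact ⟨b, a, h', by omega, h.symm⟩
    obtain ⟨d, rfl⟩ := Nat.exists_eq_add_of_lt hij
    obtain ⟨m, rfl⟩ := Nat.exists_eq_add_of_le hjl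
    set c := d + 1 with hcd
    have hpc : p (i + c) = p i := hpij.symm
    have hcirc := hc c (fun t => p (i + t)) (by simpa using hpc)
      (fun t ht => hp (i + t) (by omega))
    let q : ℕ → N := fun t => if t ≤ i then p t else p (t + c)
    have hq1 : ∀ t ≤ i, q t = p t := fun t ht => if_pos ht
    have hq2 : ∀ t, q (i + t) = p (i + c + t) := fun t => by
      rcases Nat.eq_zero_or_pos t with rfl | ht
      · rw [Nat.add_zero, Nat.add_zero, hq1 i le_rfl, hpc]
      · exact (if_neg (by omega)).trans (congrArg p (by omega))
    have hrest := ih (i + m) (by omega) q (fun t ht => by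
      rcases lt_or_ge t i with h | h
      · rw [hq1 _ h.le, hq1 _ h]
        exact hp t (by omega)
      · obtain ⟨s, rfl⟩ := Nat.exists_eq_add_of_le h
        rw [Nat.add_assoc, hq2, hq2]
        exact hp (i + c + s) (by omega))
    rw [Finset.sum_range_add] at hrest
    have h1 : ∑ t ∈ Finset.range i, w (q (t + 1)) (q t) =
        ∑ t ∈ Finset.range i, w (p (t + 1)) (p t) :=
      Finset.sum_congr rfl fun t ht => by
        have := Finset.mem_range.1 ht
        rw [hq1 _ this, hq1 _ this.le]
    have h2 : ∑ t ∈ Finset.range m, w (q (i + t + 1)) (q (i + t)) =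
        ∑ t ∈ Finset.range m, w (p (i + c + t + 1)) (p (i + c + t)) :=
      Finset.sum_congr rfl fun t _ => by
        rw [Nat.add_assoc i, hq2, hq2, Nat.add_assoc (i + c)]
    rw [h1, h2] at hrest
    have hsplit : ∑ t ∈ Finset.range (i + c + m), w (p (t + 1)) (p t) =
        ∑ t ∈ Finset.range i, w (p (t + 1)) (p t) +
        ∑ t ∈ Finset.range c, w (p (i + t + 1)) (p (i + t)) +
        ∑ t ∈ Finset.range m, w (p (i + c + t + 1)) (p (i + c + t)) := by
      rw [Finset.sum_range_add, Finset.sum_range_add]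
    have hcirc' : ∑ t ∈ Finset.range c, w (p (i + t + 1)) (p (i + t)) ≤ 0 := hcirc
    change ∑ t ∈ Finset.range (i + c + m), w (p (t + 1)) (p t) ≤ _
    rw [hsplit]
    linarith

/-- A finite weighted digraph without positive-weight circuits admits a potential. -/
theorem exists_potential {N : Type*} [Finite N] (E : N → N → Prop) (w : N → N → ℝ)
    (hc : ∀ (l : ℕ) (p : ℕ → N), p l = p 0 → (∀ t < l, E (p (t + 1)) (p t)) →
      ∑ t ∈ Finset.range l, w (p (t + 1)) (p t) ≤ 0) :
    ∃ x : N → ℝ, ∀ i j, E i j → w i j + x j ≤ x i := by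
  obtain ⟨M, hM⟩ := exists_walk_weight_le E w hc
  let S : N → Set ℝ := fun i => {s | ∃ (l : ℕ) (p : ℕ → N),
    (∀ t < l, E (p (t + 1)) (p t)) ∧ p l = i ∧
      ∑ t ∈ Finset.range l, w (p (t + 1)) (p t) = s}
  have hne : ∀ i, (S i).Nonempty := fun i => ⟨0, 0, fun _ => i, by simp, rfl, by simp⟩
  have hbdd : ∀ i, BddAbove (S i) := fun i => ⟨M, by
    rintro s ⟨l, p, hp, -, rfl⟩
    exact hM l p hp⟩
  refine ⟨fun i => sSup (S i), fun i j hij => ?_⟩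
  rw [← le_sub_iff_add_le']
  refine csSup_le (hne j) ?_
  rintro s ⟨l, p, hp, rfl, rfl⟩
  rw [le_sub_iff_add_le']
  refine le_csSup (hbdd i) ⟨l + 1, fun t => if t ≤ l then p t else i, ?_, ?_, ?_⟩
  · intro t ht
    rcases Nat.lt_succ_iff_lt_or_eq.1 ht with h | rfl
    · simpa [h.le, Nat.succ_le_of_lt h] using hp t h
    · simpa using hij
  · simp
  · rw [Finset.sum_range_succ, add_comm]
    congr 1
    · simp
    · refine Finset.sum_congr rfl fun t ht => ?_
      have h := Finset.mem_range.1 ht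
      simp [h.le, Nat.succ_le_of_lt h]

/-- A matrix over `ℝ_max` admits a finite subeigenvector for the eigenvalue `0` iff its precedence
graph has no positive-weight circuit. -/
theorem exists_real_subsolution_iff {N : Type*} [Finite N] (A : N → N → EReal)
    (hA : ∀ i j, A i j ≠ ⊤) :
    (∃ x : N → ℝ, ∀ i j, A i j + (x j : EReal) ≤ x i) ↔ ¬ hasPosCircuit A := by
  have hcoe : ∀ i j, A i j ≠ ⊥ → A i j = ((A i j).toReal : EReal) := fun i j h =>
    (EReal.coe_toReal (hA i j) h).symm
  have hsum : ∀ (l : ℕ) (p : ℕ → N), (∀ t < l, A (p (t + 1)) (p t) ≠ ⊥) →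
      ∑ t ∈ Finset.range l, A (p (t + 1)) (p t) =
        ((∑ t ∈ Finset.range l, (A (p (t + 1)) (p t)).toReal : ℝ) : EReal) := by
    intro l p hp
    induction l with
    | zero => simp
    | succ l ih =>
      rw [Finset.sum_range_succ, Finset.sum_range_succ, EReal.coe_add,
        ih fun t ht => hp t (ht.trans l.lt_succ_self), ← hcoe _ _ (hp l l.lt_succ_self)]
  constructor
  · rintro ⟨x, hx⟩ ⟨l, p, hpl, hp, hpos⟩
    rw [hsum l p hp, ← EReal.coe_zero, EReal.coe_lt_coe_iff] at hpos
    refine hpos.not_ge ?_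
    calc ∑ t ∈ Finset.range l, (A (p (t + 1)) (p t)).toReal
        ≤ ∑ t ∈ Finset.range l, (x (p (t + 1)) - x (p t)) := by
          refine Finset.sum_le_sum fun t ht => ?_
          have h := hx (p (t + 1)) (p t)
          rw [hcoe _ _ (hp t (Finset.mem_range.1 ht)), ← EReal.coe_add,
            EReal.coe_le_coe_iff] at h
          linarith
      _ = 0 := by rw [Finset.sum_range_sub (fun t => x (p t)), hpl, sub_self]
  · intro h
    obtain ⟨x, hx⟩ := exists_potential (fun i j => A i j ≠ ⊥) (fun i j => (A i j).toReal)
      (fun l p hpl hp => by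
        by_contra! hpos
        refine h ⟨l, p, hpl, hp, ?_⟩
        rw [hsum l p hp]
        exact_mod_cast hpos)
    refine ⟨x, fun i j => ?_⟩
    by_cases hij : A i j = ⊥
    · simp [hij]
    · rw [hcoe i j hij]
      exact_mod_cast hx i j hij

theorem MK_ne_top {n : ℕ} {L C R : Fin n → Fin n → EReal}
    (hL : ∀ i j, L i j ≠ ⊤) (hC : ∀ i j, C i j ≠ ⊤) (hR : ∀ i j, R i j ≠ ⊤)
    (K : ℕ) (p q : Fin K × Fin n) : MK L C R K p q ≠ ⊤ := by
  unfold MK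
  split_ifs
  exacts [hC _ _, hL _ _, hR _ _, bot_ne_top]

theorem finiteTraj_iff_exists_MK {n : ℕ} (L C R : Fin n → Fin n → EReal) (K : ℕ) :
    FiniteTraj L C R K ↔
      ∃ x : Fin K × Fin n → ℝ, ∀ p q, MK L C R K p q + (x q : EReal) ≤ x p := by
  constructor
  · rintro ⟨x, hC, hLR⟩
    refine ⟨fun p => x p.1 p.2, ?_⟩
    rintro ⟨⟨a, ha⟩, i⟩ ⟨⟨b, hb⟩, j⟩
    simp only [MK]
    split_ifs with h1 h2 h3
    · subst h1
      exact iSup_le_iff.1 (hC ⟨a, ha⟩ i) j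
    · subst h2
      exact iSup_le_iff.1 (hLR ⟨a, ha⟩ hb i).1 j
    · subst h3
      exact iSup_le_iff.1 (hLR ⟨b, hb⟩ ha i).2 j
    · simp
  · rintro ⟨x, hx⟩
    refine ⟨fun k i => x (k, i), fun k i => iSup_le fun j => ?_, fun k h i =>
      ⟨iSup_le fun j => ?_, iSup_le fun j => ?_⟩⟩
    · simpa [MK] using hx (k, i) (k, j)
    · simpa [MK] using hx (k, i) (⟨k + 1, h⟩, j)
    · have h2 : ¬ (k.val + 1 + 1 = k.val) := by omega
      simpa [MK, h2] using hx (⟨k + 1, h⟩, i) (k, j)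

/-- a finite trajectory of horizon `K` exists iff `G(M_[K])` has
no positive-weight circuit; consequently, the system is weakly consistent iff
for all `K`, `G(M_[K])` has no positive-weight circuit. -/
theorem stmt_5 (n : ℕ) (hn : 0 < n) (L C R : Fin n → Fin n → EReal)
    (hL : ∀ i j, L i j ≠ ⊤) (hC : ∀ i j, C i j ≠ ⊤) (hR : ∀ i j, R i j ≠ ⊤) :
    (∀ K : ℕ, FiniteTraj L C R K ↔ ¬ hasPosCircuit (MK L C R K)) ∧
    (WeaklyConsistent L C R ↔ ∀ K : ℕ, ¬ hasPosCircuit (MK L C R K)) := by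
  have key : ∀ K : ℕ, FiniteTraj L C R K ↔ ¬ hasPosCircuit (MK L C R K) := fun K =>
    (finiteTraj_iff_exists_MK L C R K).trans
      (exists_real_subsolution_iff _ (MK_ne_top hL hC hR K))
  exact ⟨key, forall_congr' key⟩
end
end
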